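/- Let V be a module of finite length over a ring R, τ a simple subquotient of V of multiplicity one, and (U,W) the maximal pair of submodules with W ⊆ U and U/W ≅ τ. Then U is the maximal submodule of V admitting τ as a quotient of one of its subquotients in the following sense: for any submodule U'' of V such that τ is a quotient of U''/W'' for some submodule W'' ⊆ U'', one has U'' ⊆ U whenever U''/W'' ≅ τ. -/

import Mathlib

/-- The subquotient module `U / W` (more precisely `U / (W ∩ U)`) associated to a pair of
submodules of `V`. -/
abbrev SubQuot (R : Type*) [Ring R] {V : Type*} [AddCommGroup V] [Module R V]
    (W U : Submodule R V) :=
  ↥U ⧸ Submodule.comap U.subtype W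

/-- `s` is a composition series of the module `V`. -/
def IsCompSeries (R : Type*) [Ring R] {V : Type*} [AddCommGroup V] [Module R V] {k : ℕ}
    (s : Fin (k + 1) → Submodule R V) : Prop :=
  s 0 = ⊥ ∧ s (Fin.last k) = ⊤ ∧
    ∀ i : Fin k, s i.castSucc ≤ s i.succ ∧
      IsSimpleModule R (SubQuot R (s i.castSucc) (s i.succ))

/-- `τ` occurs with multiplicity one among the Jordan–Hölder factors of `V`. -/
def MultOne (R : Type*) [Ring R] (V : Type*) [AddCommGroup V] [Module R V]
    (τ : Type*) [AddCommGroup τ] [Module R τ] : Prop :=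
  ∀ (k : ℕ) (s : Fin (k + 1) → Submodule R V), IsCompSeries R s →
    ∃! i : Fin k, Nonempty (SubQuot R (s i.castSucc) (s i.succ) ≃ₗ[R] τ)


theorem SubQuot.covBy {R V τ : Type*} [Ring R] [AddCommGroup V] [Module R V]
    [AddCommGroup τ] [Module R τ] [IsSimpleModule R τ] {A B : Submodule R V} (hAB : A ≤ B)
    (e : Nonempty (SubQuot R A B ≃ₗ[R] τ)) : A ⋖ B :=
  (covBy_iff_quot_is_simple hAB).2 (IsSimpleModule.congr e.some)

/-- Over a covering pair `A ⋖ B`, a submodule containing `A` but not `B` has the same subquotient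
under `B ⊔ N`. -/
theorem SubQuot.nonempty_equiv_sup {R V : Type*} [Ring R] [AddCommGroup V] [Module R V]
    {A B N : Submodule R V} (hAB : A ⋖ B) (hAN : A ≤ N) (hBN : ¬ B ≤ N) :
    Nonempty (SubQuot R A B ≃ₗ[R] SubQuot R N (B ⊔ N)) := by
  have h : B ⊓ N = A := by
    rcases hAB.eq_or_eq (le_inf hAB.le hAN) inf_le_left with h | h
    · exact h
    · exact absurd (inf_eq_left.1 h) hBN
  subst h
  exact ⟨LinearMap.quotientInfEquivSupQuotient B N⟩

/-- A strictly increasing family of submodules of a finite length module refines to a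
composition series. -/
theorem IsFiniteLength.exists_isCompSeries {R V : Type*} [Ring R] [AddCommGroup V] [Module R V]
    (hfl : IsFiniteLength R V) (p : LTSeries (Submodule R V)) :
    ∃ (k : ℕ) (s : Fin (k + 1) → Submodule R V), IsCompSeries R s ∧ StrictMono s ∧
      ∀ j, ∃ i, s i = p j := by
  obtain ⟨_, _⟩ := isFiniteLength_iff_isNoetherian_isArtinian.1 hfl
  obtain ⟨t, i, hi, h0, h1⟩ := p.exists_relSeries_covBy_and_head_eq_bot_and_last_eq_bot
  have hstep : ∀ j : Fin t.length, t j.castSucc ⋖ t j.succ := t.step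
  exact ⟨t.length, t, ⟨h0, h1, fun j ↦ ⟨(hstep j).le,
    (covBy_iff_quot_is_simple (hstep j).le).1 (hstep j)⟩⟩,
    Fin.strictMono_iff_lt_succ.2 fun j ↦ (hstep j).lt, fun j ↦ ⟨i j, congrFun hi j⟩⟩

theorem StrictMono.exists_castSucc_succ_of_covBy {α : Type*} [PartialOrder α] {k : ℕ}
    {s : Fin (k + 1) → α} (hs : StrictMono s) {a b : Fin (k + 1)} (h : s a ⋖ s b) :
    ∃ i : Fin k, i.castSucc = a ∧ i.succ = b := by
  have hab : a < b := hs.lt_iff_lt.1 h.lt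
  refine ⟨⟨a, by have := b.2; have : a.1 < b.1 := hab; lia⟩, rfl, ?_⟩
  by_contra hne
  have hlt : (⟨a + 1, by have := b.2; have : a.1 < b.1 := hab; lia⟩ : Fin (k + 1)) < b :=
    lt_of_le_of_ne (Nat.succ_le_of_lt hab) hne
  exact h.2 (hs (show a.1 < a.1 + 1 by lia)) (hs hlt)

/-- A composition factor of multiplicity one does not occur in two consecutive layers. -/
theorem MultOne.false_of_le {R V τ : Type*} [Ring R] [AddCommGroup V] [Module R V]
    [AddCommGroup τ] [Module R τ] [IsSimpleModule R τ] (hfl : IsFiniteLength R V)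
    (hmult : MultOne R V τ) {A B C D : Submodule R V} (hAB : A ≤ B) (hBC : B ≤ C) (hCD : C ≤ D)
    (e : Nonempty (SubQuot R A B ≃ₗ[R] τ)) (e' : Nonempty (SubQuot R C D ≃ₗ[R] τ)) : False := by
  have hAB' := SubQuot.covBy hAB e
  have hCD' := SubQuot.covBy hCD e'
  obtain ⟨k, s, hs, hmono, a, b, c, d, rfl, rfl, rfl, rfl⟩ :
      ∃ (k : ℕ) (s : Fin (k + 1) → Submodule R V), IsCompSeries R s ∧ StrictMono s ∧
        ∃ a b c d, s a = A ∧ s b = B ∧ s c = C ∧ s d = D := by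
    rcases hBC.eq_or_lt with rfl | hlt
    · obtain ⟨k, s, hs, hmono, h⟩ := hfl.exists_isCompSeries ⟨2, ![A, B, D], by
        intro i; fin_cases i
        exacts [hAB'.lt, hCD'.lt]⟩
      obtain ⟨a, ha⟩ := h 0
      obtain ⟨b, hb⟩ := h 1
      obtain ⟨d, hd⟩ := h 2
      exact ⟨k, s, hs, hmono, a, b, b, d, ha, hb, hb, hd⟩
    · obtain ⟨k, s, hs, hmono, h⟩ := hfl.exists_isCompSeries ⟨3, ![A, B, C, D], by
        intro i; fin_cases i
        exacts [hAB'.lt, hlt, hCD'.lt]⟩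
      obtain ⟨a, ha⟩ := h 0
      obtain ⟨b, hb⟩ := h 1
      obtain ⟨c, hc⟩ := h 2
      obtain ⟨d, hd⟩ := h 3
      exact ⟨k, s, hs, hmono, a, b, c, d, ha, hb, hc, hd⟩
  obtain ⟨i, rfl, rfl⟩ := hmono.exists_castSucc_succ_of_covBy hAB'
  obtain ⟨j, rfl, rfl⟩ := hmono.exists_castSucc_succ_of_covBy hCD'
  obtain rfl := (hmult k s hs).unique e e'
  exact (hAB'.lt.trans_le hBC).false

/-- If `τ` has multiplicity one, then `U` with `U / W ≅ τ` is not contained in `W ⊔ W'` when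
`U' / W' ≅ τ`. -/
theorem MultOne.not_le_sup {R V τ : Type*} [Ring R] [AddCommGroup V] [Module R V]
    [AddCommGroup τ] [Module R τ] [IsSimpleModule R τ] (hfl : IsFiniteLength R V)
    (hmult : MultOne R V τ) {U W U' W' : Submodule R V} (hWU : W ≤ U) (hWU' : W' ≤ U')
    (e : Nonempty (SubQuot R W U ≃ₗ[R] τ)) (e' : Nonempty (SubQuot R W' U' ≃ₗ[R] τ)) :
    ¬ U ≤ W ⊔ W' := by
  intro hle
  have hsup : U ⊓ W' ⊔ W = U := by
    rw [sup_comm, inf_comm, ← sup_inf_assoc_of_le W' hWU, inf_eq_right.2 hle]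
  have f : Nonempty (SubQuot R (U ⊓ W' ⊓ W) (U ⊓ W') ≃ₗ[R] SubQuot R W (U ⊓ W' ⊔ W)) :=
    ⟨LinearMap.quotientInfEquivSupQuotient _ _⟩
  rw [hsup] at f
  exact hmult.false_of_le hfl inf_le_left inf_le_right hWU' ⟨f.some.trans e.some⟩ e'

theorem statement13 {R : Type*} [Ring R] {V : Type*} [AddCommGroup V] [Module R V]
    (hfl : IsFiniteLength R V)
    {τ : Type*} [AddCommGroup τ] [Module R τ] (hτ : IsSimpleModule R τ)
    (hmult : MultOne R V τ)
    (U W : Submodule R V) (hWU : W ≤ U) (hiso : Nonempty (SubQuot R W U ≃ₗ[R] τ))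
    (hmax : ∀ U₁ W₁ : Submodule R V, W₁ ≤ U₁ →
      Nonempty (SubQuot R W₁ U₁ ≃ₗ[R] τ) → U ≤ U₁ → U₁ = U) :
    ∀ U'' W'' : Submodule R V, W'' ≤ U'' →
      Nonempty (SubQuot R W'' U'' ≃ₗ[R] τ) → U'' ≤ U := by
  intro U' W' hWU' hiso'
  have hU : ¬ U ≤ W ⊔ W' := hmult.not_le_sup hfl hWU hWU' hiso hiso'
  obtain ⟨f⟩ := SubQuot.nonempty_equiv_sup (SubQuot.covBy hWU hiso) le_sup_left hU
  have e : Nonempty (SubQuot R (W ⊔ W') (U ⊔ (W ⊔ W')) ≃ₗ[R] τ) := ⟨f.symm.trans hiso.some⟩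
  have hU' : U' ≤ U ⊔ (W ⊔ W') := by
    by_contra hnot
    obtain ⟨g⟩ := SubQuot.nonempty_equiv_sup (SubQuot.covBy hWU' hiso')
      (le_sup_right.trans le_sup_right) hnot
    exact hmult.false_of_le hfl le_sup_right le_rfl le_sup_right e ⟨g.symm.trans hiso'.some⟩
  exact hU'.trans_eq (hmax _ _ le_sup_right e le_sup_left)
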